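/- arXiv:2101.10694 — 8 statements merged into one kernel-verified Lean document; each statement's English description precedes it below -/
import Mathlib

section
/- Let m, u, t be natural numbers with u ≤ m and u + 1 ≤ t ≤ 2u. The number of ordered pairs (i, i′) of binary patterns of length m, each of weight exactly u, with Hamming distance d_h(i,i′) = 2(t − u), equals C(m,t)·C(t,u)·C(u, 2u − t), where C(·,·) is the binomial coefficient (which vanishes when t > m, consistently with no such pairs existing). -/
open Finset

/-- The weight of a binary pattern: the number of positions where it equals `true`. -/
def wt {α : Type*} [Fintype α] (i : α → Bool) : ℕ :=
  (Finset.univ.filter fun a => i a = true).card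

/-- Ordered pairs of `u`-subsets whose union has `t` elements correspond to chains
`A ∩ B ⊆ A ⊆ A ∪ B`. -/
lemma card_pairs_card_union_eq {α : Type*} [Fintype α] [DecidableEq α] {u t : ℕ}
    (hut : u ≤ t) (htu : t ≤ 2 * u) :
    #{p : Finset α × Finset α | #p.1 = u ∧ #p.2 = u ∧ #(p.1 ∪ p.2) = t}
      = (Fintype.card α).choose t * t.choose u * u.choose (2 * u - t) := by
  have chains : #((powersetCard t (univ : Finset α)).sigma fun T =>
      (powersetCard u T).sigma fun A => powersetCard (2 * u - t) A)
      = (Fintype.card α).choose t * t.choose u * u.choose (2 * u - t) := by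
    have inner : ∀ T ∈ powersetCard t (univ : Finset α),
        #((powersetCard u T).sigma fun A => powersetCard (2 * u - t) A)
          = t.choose u * u.choose (2 * u - t) := by
      intro T hT
      rw [card_sigma, sum_congr rfl fun A hA => by
        rw [card_powersetCard, (mem_powersetCard.1 hA).2]]
      rw [sum_const, card_powersetCard, (mem_powersetCard.1 hT).2, smul_eq_mul]
    rw [card_sigma, sum_congr rfl inner, sum_const, card_powersetCard, card_univ, smul_eq_mul,
      mul_assoc]
  rw [← chains]
  refine card_nbij' (fun p => ⟨p.1 ∪ p.2, p.1, p.1 ∩ p.2⟩)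
    (fun x => (x.2.1, (x.1 \ x.2.1) ∪ x.2.2)) ?_ ?_ ?_ ?_
  · rintro ⟨A, B⟩ h
    simp only [coe_filter, mem_univ, true_and, Set.mem_ofPred_eq] at h
    have := card_union_add_card_inter A B
    simp only [mem_coe, mem_sigma, mem_powersetCard, subset_univ, subset_union_left,
      inter_subset_left, true_and]
    omega
  · rintro ⟨T, A, C⟩ h
    simp only [mem_coe, mem_sigma, mem_powersetCard, subset_univ, true_and] at h
    obtain ⟨hT, ⟨hAT, hA⟩, hCA, hC⟩ := h
    simp only [coe_filter, mem_univ, true_and, Set.mem_ofPred_eq]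
    refine ⟨hA, ?_, ?_⟩
    · rw [card_union_of_disjoint (disjoint_sdiff_self_left.mono_right hCA),
        card_sdiff_of_subset hAT]
      omega
    · rw [← union_assoc, union_sdiff_of_subset hAT, union_eq_left.2 (hCA.trans hAT), hT]
  · rintro ⟨A, B⟩ -
    ext x <;> simp
    tauto
  · rintro ⟨T, A, C⟩ h
    simp only [mem_coe, mem_sigma, mem_powersetCard, subset_univ, true_and] at h
    obtain ⟨-, ⟨hAT, -⟩, hCA, -⟩ := h
    have hunion : A ∪ (T \ A ∪ C) = T := by
      rw [← union_assoc, union_sdiff_of_subset hAT, union_eq_left.2 (hCA.trans hAT)]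
    have hinter : A ∩ (T \ A ∪ C) = C := by
      rw [inter_union_distrib_left, inter_sdiff_self, empty_union, inter_eq_right.2 hCA]
    simp only [hunion, hinter]

/-- The Hamming distance of two binary patterns in terms of their supports. -/
lemma hammingDist_add_wt_add_wt {α : Type*} [Fintype α] [DecidableEq α] (i j : α → Bool) :
    hammingDist i j + wt i + wt j
      = 2 * #(({a | i a = true} : Finset α) ∪ ({a | j a = true} : Finset α)) := by
  simp only [hammingDist, wt, ← filter_or, card_filter, mul_sum, ← sum_add_distrib]
  refine sum_congr rfl fun a _ => ?_
  cases i a <;> cases j a <;> simp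

/-- The number of ordered pairs of binary patterns of length `m`, each of weight
exactly `u` (the `u`-CPF image space), with Hamming distance `2(t-u)`, equals
`C(m,t) C(t,u) C(u, 2u-t)`. -/
theorem stmt1 (m u t : ℕ) (hum : u ≤ m) (ht1 : u + 1 ≤ t) (ht2 : t ≤ 2 * u) :
    ((Finset.univ : Finset ((Fin m → Bool) × (Fin m → Bool))).filter
        (fun q => wt q.1 = u ∧ wt q.2 = u ∧ hammingDist q.1 q.2 = 2 * (t - u))).card
      = m.choose t * t.choose u * u.choose (2 * u - t) := by
  have pairs := card_pairs_card_union_eq (α := Fin m) (by omega : u ≤ t) ht2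
  rw [Fintype.card_fin] at pairs
  rw [← pairs]
  refine card_nbij' (fun q => (({a | q.1 a = true} : Finset _), ({a | q.2 a = true} : Finset _)))
    (fun p => (fun a => decide (a ∈ p.1), fun a => decide (a ∈ p.2))) ?_ ?_ ?_ ?_
  · rintro ⟨i, j⟩ h
    have := hammingDist_add_wt_add_wt i j
    simp only [coe_filter, mem_univ, true_and, Set.mem_ofPred_eq] at h ⊢
    obtain ⟨hi, hj, hd⟩ := h
    exact ⟨hi, hj, by omega⟩
  · rintro ⟨A, B⟩ h
    have := hammingDist_add_wt_add_wt (fun a => decide (a ∈ A)) (fun a => decide (a ∈ B))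
    simp only [coe_filter, mem_univ, true_and, Set.mem_ofPred_eq] at h ⊢
    simp only [wt, decide_eq_true_eq, filter_univ_mem] at this ⊢
    omega
  · rintro ⟨i, j⟩ -
    simp
  · rintro ⟨A, B⟩ -
    simp
end

section
/- Let i, i′ be binary patterns of length m, both of weight u, with Hamming distance d = d_h(i,i′) (necessarily even). Then the product of w(e) over all unordered pairs e = {a,b} of distinct positions in {1,…,m} equals F01^(d(2(m−u)−d)/2) · F11^(d²/4) · F02^(d(d−2)/4) · F12^(d(2u−d)/2). (All four exponents are natural numbers since d is even.) -/
open Finset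

/-- Restricted weight of a pattern on a pair of positions: `i_a + i_b ∈ {0,1,2}`. -/
def rwt {α : Type*} (i : α → Bool) (a b : α) : ℕ :=
  (i a).toNat + (i b).toNat

/-- The two-mode sub-fidelity weight of a pair of distinct positions `{a,b}`:
`1` if the restrictions of `i` and `i'` coincide; `F01` if the unordered pair of
restricted weights is `{0,1}`; `F11` if both restricted weights are `1` but the
restrictions differ; `F02` for restricted weights `{0,2}`; `F12` for `{1,2}`. -/
noncomputable def w {α : Type*} (F01 F11 F02 F12 : ℝ) (i i' : α → Bool) (a b : α) : ℝ :=
  if (i a, i b) = (i' a, i' b) then 1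
  else if rwt i a b + rwt i' a b = 1 then F01
  else if rwt i a b + rwt i' a b = 3 then F12
  else if rwt i a b = 1 then F11
  else F02

/-- Product of `w` over all unordered pairs `{a,b}` of distinct positions,
encoded as ordered pairs with `a < b`. -/
noncomputable def Wfull {m : ℕ} (F01 F11 F02 F12 : ℝ) (i i' : Fin m → Bool) : ℝ :=
  ∏ p ∈ Finset.univ.filter (fun p : Fin m × Fin m => p.1 < p.2),
    w F01 F11 F02 F12 i i' p.1 p.2

/-- The number of positions at which the pair of patterns takes a given pair of values. -/
def jointCount {α : Type*} [Fintype α] (i i' : α → Bool) (c : Bool × Bool) : ℕ :=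
  (Finset.univ.filter fun a => (i a, i' a) = c).card

lemma wt_left_eq_jointCount {α : Type*} [Fintype α] (i i' : α → Bool) :
    wt i = jointCount i i' (true, false) + jointCount i i' (true, true) := by
  simp only [wt, jointCount, Finset.card_filter, ← Finset.sum_add_distrib]
  refine Finset.sum_congr rfl fun a _ => ?_
  cases i a <;> cases i' a <;> simp

lemma wt_right_eq_jointCount {α : Type*} [Fintype α] (i i' : α → Bool) :
    wt i' = jointCount i i' (false, true) + jointCount i i' (true, true) := by
  simp only [wt, jointCount, Finset.card_filter, ← Finset.sum_add_distrib]
  refine Finset.sum_congr rfl fun a _ => ?_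
  cases i a <;> cases i' a <;> simp

lemma hammingDist_eq_jointCount {α : Type*} [Fintype α] (i i' : α → Bool) :
    hammingDist i i' = jointCount i i' (true, false) + jointCount i i' (false, true) := by
  simp only [hammingDist, jointCount, Finset.card_filter, ← Finset.sum_add_distrib]
  refine Finset.sum_congr rfl fun a _ => ?_
  cases i a <;> cases i' a <;> simp

lemma card_eq_jointCount {α : Type*} [Fintype α] (i i' : α → Bool) :
    Fintype.card α = jointCount i i' (true, false) + jointCount i i' (false, true) +
      jointCount i i' (true, true) + jointCount i i' (false, false) := by
  simp only [Fintype.card_eq_sum_ones, jointCount, Finset.card_filter, ← Finset.sum_add_distrib]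
  refine Finset.sum_congr rfl fun a _ => ?_
  cases i a <;> cases i' a <;> simp

lemma prod_joint_eq_prod_pow_jointCount {α M : Type*} [Fintype α] [CommMonoid M]
    (i i' : α → Bool) (f : Bool × Bool → M) :
    ∏ a, f (i a, i' a) = ∏ c, f c ^ jointCount i i' c := by
  rw [← Finset.prod_fiberwise Finset.univ fun a => (i a, i' a)]
  refine Finset.prod_congr rfl fun c _ => ?_
  rw [jointCount, ← Finset.prod_const]
  refine Finset.prod_congr rfl fun a ha => ?_
  rw [(Finset.mem_filter.mp ha).2]

lemma sq_prod_lt_mul_prod_diag {α M : Type*} [Fintype α] [LinearOrder α] [CommMonoid M]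
    (g : α → α → M) (hsymm : ∀ a b, g a b = g b a) :
    (∏ p ∈ Finset.univ.filter (fun p : α × α => p.1 < p.2), g p.1 p.2) ^ 2 * ∏ a, g a a =
      ∏ a, ∏ b, g a b := by
  have hswap : ∏ p : α × α, (if p.1 < p.2 then g p.1 p.2 else 1) =
      ∏ p : α × α, if p.2 < p.1 then g p.1 p.2 else 1 := by
    rw [← Equiv.prod_comp (Equiv.prodComm α α)]
    simp [hsymm]
  have hdiag : ∏ a, g a a = ∏ p : α × α, if p.1 = p.2 then g p.1 p.2 else 1 := by
    simp [Fintype.prod_prod_type]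
  rw [← Fintype.prod_prod_type' g, Finset.prod_filter, sq, hdiag]
  nth_rewrite 2 [hswap]
  rw [← Finset.prod_mul_distrib, ← Finset.prod_mul_distrib]
  refine Finset.prod_congr rfl fun p _ => ?_
  rcases lt_trichotomy p.1 p.2 with h | h | h
  · simp [h, h.not_gt, h.ne]
  · simp [h]
  · simp [h, h.not_gt, h.ne']

lemma w_comm {α : Type*} (F01 F11 F02 F12 : ℝ) (i i' : α → Bool) (a b : α) :
    w F01 F11 F02 F12 i i' a b = w F01 F11 F02 F12 i i' b a := by
  unfold w rwt
  cases i a <;> cases i b <;> cases i' a <;> cases i' b <;> simp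

lemma w_pos {α : Type*} {F01 F11 F02 F12 : ℝ} (hF01 : 0 < F01) (hF11 : 0 < F11)
    (hF02 : 0 < F02) (hF12 : 0 < F12) (i i' : α → Bool) (a b : α) :
    0 < w F01 F11 F02 F12 i i' a b := by
  unfold w
  split_ifs <;> first | assumption | exact one_pos

lemma sq_Wfull_mul_prod_diag {m : ℕ} (F01 F11 F02 F12 : ℝ) (i i' : Fin m → Bool) :
    Wfull F01 F11 F02 F12 i i' ^ 2 *
        ∏ c, w F01 F11 F02 F12 Prod.fst Prod.snd c c ^ jointCount i i' c =
      ∏ c, (∏ c', w F01 F11 F02 F12 Prod.fst Prod.snd c c' ^ jointCount i i' c') ^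
        jointCount i i' c := by
  set v := w F01 F11 F02 F12 (Prod.fst : Bool × Bool → Bool) Prod.snd
  have hW := sq_prod_lt_mul_prod_diag _ (w_comm F01 F11 F02 F12 i i')
  have hdiag : ∏ a, w F01 F11 F02 F12 i i' a a = ∏ c, v c c ^ jointCount i i' c :=
    prod_joint_eq_prod_pow_jointCount i i' fun c => v c c
  have hall : ∏ a, ∏ b, w F01 F11 F02 F12 i i' a b =
      ∏ c, (∏ c', v c c' ^ jointCount i i' c') ^ jointCount i i' c := by
    rw [← prod_joint_eq_prod_pow_jointCount i i' fun c => ∏ c', v c c' ^ jointCount i i' c']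
    exact Finset.prod_congr rfl fun a _ =>
      prod_joint_eq_prod_pow_jointCount i i' (v (i a, i' a))
  rw [hdiag, hall] at hW
  exact hW

lemma sq_Wfull_mul_pow {m : ℕ} (F01 F11 F02 F12 : ℝ) (i i' : Fin m → Bool) {k p q : ℕ}
    (hA : jointCount i i' (true, false) = k) (hB : jointCount i i' (false, true) = k)
    (hp : jointCount i i' (true, true) = p) (hq : jointCount i i' (false, false) = q) :
    Wfull F01 F11 F02 F12 i i' ^ 2 * F02 ^ (2 * k) =
      (F01 ^ (2 * (k * q)) * F11 ^ (k ^ 2) * F12 ^ (2 * (k * p))) ^ 2 * F02 ^ (2 * k ^ 2) := by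
  have hW := sq_Wfull_mul_prod_diag F01 F11 F02 F12 i i'
  simp only [Fintype.prod_prod_type, Fintype.prod_bool, hA, hB, hp, hq] at hW
  simp [w, rwt] at hW
  rw [two_mul, pow_add, hW]
  ring

/-- For two patterns of equal weight `u` at Hamming distance `d`, the product of
`w` over all unordered pairs of distinct positions equals
`F01^(d(2(m-u)-d)/2) F11^(d²/4) F02^(d(d-2)/4) F12^(d(2u-d)/2)`. -/
theorem stmt3 (m u : ℕ) (F01 F11 F02 F12 : ℝ)
    (hF01 : 0 < F01) (hF11 : 0 < F11) (hF02 : 0 < F02) (hF12 : 0 < F12)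
    (i i' : Fin m → Bool) (hi : wt i = u) (hi' : wt i' = u)
    (d : ℕ) (hd : hammingDist i i' = d) :
    Wfull F01 F11 F02 F12 i i' =
      F01 ^ (d * (2 * (m - u) - d) / 2) * F11 ^ (d ^ 2 / 4) *
        F02 ^ (d * (d - 2) / 4) * F12 ^ (d * (2 * u - d) / 2) := by
  rw [wt_left_eq_jointCount i i'] at hi
  rw [wt_right_eq_jointCount i i'] at hi'
  rw [hammingDist_eq_jointCount] at hd
  have hm := card_eq_jointCount i i'
  rw [Fintype.card_fin] at hm
  have hpos : 0 < Wfull F01 F11 F02 F12 i i' :=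
    Finset.prod_pos fun p _ => w_pos hF01 hF11 hF02 hF12 i i' p.1 p.2
  obtain ⟨k, hk⟩ : ∃ k, jointCount i i' (true, false) = k := ⟨_, rfl⟩
  obtain ⟨p, hp⟩ : ∃ p, jointCount i i' (true, true) = p := ⟨_, rfl⟩
  obtain ⟨q, hq⟩ : ∃ q, jointCount i i' (false, false) = q := ⟨_, rfl⟩
  have hl : jointCount i i' (false, true) = k := by omega
  have hW := sq_Wfull_mul_pow F01 F11 F02 F12 i i' hk hl hp hq
  rw [hk, hl] at hd
  rw [hk, hp] at hi
  rw [hk, hl, hp, hq] at hm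
  have h01 : d * (2 * (m - u) - d) / 2 = 2 * (k * q) := by
    have h : 2 * (m - u) - d = 2 * q := by omega
    rw [h, ← hd]
    exact Nat.div_eq_of_eq_mul_left two_pos (by ring)
  have h12 : d * (2 * u - d) / 2 = 2 * (k * p) := by
    have h : 2 * u - d = 2 * p := by omega
    rw [h, ← hd]
    exact Nat.div_eq_of_eq_mul_left two_pos (by ring)
  have h11 : d ^ 2 / 4 = k ^ 2 := by
    rw [← hd]
    exact Nat.div_eq_of_eq_mul_left four_pos (by ring)
  have h02 : d * (d - 2) / 4 = k * (k - 1) := by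
    have h : d - 2 = 2 * (k - 1) := by omega
    rw [h, ← hd]
    exact Nat.div_eq_of_eq_mul_left four_pos (by ring)
  rw [h01, h12, h11, h02]
  have hexp : k * (k - 1) * 2 + 2 * k = 2 * k ^ 2 := by
    cases k
    · rfl
    · simp only [Nat.add_sub_cancel]; ring
  have hF : (F02 ^ (k * (k - 1))) ^ 2 * F02 ^ (2 * k) = F02 ^ (2 * k ^ 2) := by
    rw [← pow_mul, ← pow_add, hexp]
  refine (pow_left_inj₀ hpos.le (by positivity) two_ne_zero).mp ?_
  refine mul_right_cancel₀ (pow_pos hF02 (2 * k)).ne' ?_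
  rw [hW, ← hF]
  generalize F02 ^ (k * (k - 1)) = x
  ring
end

section
/- Let i, i′ be binary patterns of length m with weights u and v respectively, u ≤ v, and Hamming distance d = d_h(i,i′). Among all unordered pairs e = {a,b} of distinct positions in {1,…,m}: (1) the number of pairs on which the restricted weights of i and i′ are {0,1} (in either order) equals d(2m − (u + v) − d)/2; (2) the number of pairs on which both restricted weights equal 1 but the restrictions of i and i′ differ equals (d² − (v − u)²)/4; (3) the number of pairs on which the restricted weights are {0,2} equals (d(d − 2) + (v − u)²)/4; (4) the number of pairs on which the restricted weights are {1,2} equals d((u + v) − d)/2. (All four expressions are natural numbers since d ≡ v − u (mod 2).) -/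
open Finset
open scoped Classical

/-- The restricted weights of `i` and `i'` on `{a,b}` form the unordered pair `{0,1}`. -/
def cls01 {α : Type*} (i i' : α → Bool) (a b : α) : Prop :=
  (rwt i a b = 0 ∧ rwt i' a b = 1) ∨ (rwt i a b = 1 ∧ rwt i' a b = 0)

/-- Both restricted weights equal `1` but the restrictions of `i` and `i'` differ. -/
def cls11 {α : Type*} (i i' : α → Bool) (a b : α) : Prop :=
  rwt i a b = 1 ∧ rwt i' a b = 1 ∧ (i a, i b) ≠ (i' a, i' b)

/-- The restricted weights of `i` and `i'` on `{a,b}` form the unordered pair `{0,2}`. -/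
def cls02 {α : Type*} (i i' : α → Bool) (a b : α) : Prop :=
  (rwt i a b = 0 ∧ rwt i' a b = 2) ∨ (rwt i a b = 2 ∧ rwt i' a b = 0)

/-- The restricted weights of `i` and `i'` on `{a,b}` form the unordered pair `{1,2}`. -/
def cls12 {α : Type*} (i i' : α → Bool) (a b : α) : Prop :=
  (rwt i a b = 1 ∧ rwt i' a b = 2) ∨ (rwt i a b = 2 ∧ rwt i' a b = 1)

/-- The pairs of `s ×ˢ t` whose first component is the smaller one. -/
def ltPairs {α : Type*} [LinearOrder α] (s t : Finset α) : Finset (α × α) :=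
  (s ×ˢ t).filter fun p => p.1 < p.2

theorem mem_ltPairs {α : Type*} [LinearOrder α] {s t : Finset α} {p : α × α} :
    p ∈ ltPairs s t ↔ (p.1 ∈ s ∧ p.2 ∈ t) ∧ p.1 < p.2 := by
  simp [ltPairs]

/-- Trichotomy, counted over `s ×ˢ t`. -/
theorem card_ltPairs_add_card_ltPairs_add_card_inter {α : Type*} [LinearOrder α]
    (s t : Finset α) :
    (ltPairs s t).card + (ltPairs t s).card + (s ∩ t).card = s.card * t.card := by
  have hgt : ((s ×ˢ t).filter fun p => p.2 < p.1).card = (ltPairs t s).card :=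
    Finset.card_bij' (fun p _ => p.swap) (fun p _ => p.swap)
      (by simp +contextual [ltPairs]) (by simp +contextual [ltPairs]) (by simp) (by simp)
  have heq : ((s ×ˢ t).filter fun p => p.1 = p.2).card = (s ∩ t).card :=
    Finset.card_bij' (fun p _ => p.1) (fun a _ => (a, a))
      (by simp only [mem_filter, mem_product, mem_inter]; grind)
      (by simp only [mem_filter, mem_product, mem_inter]; grind)
      (by simp only [mem_filter]; grind) (by simp)
  rw [← hgt, ← heq, ltPairs, ← Finset.card_product, ← Finset.card_union_of_disjoint,
    ← Finset.card_union_of_disjoint]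
  · congr 1
    ext p
    have := lt_trichotomy p.1 p.2
    simp only [mem_union, mem_filter]
    tauto
  · rw [Finset.disjoint_left]
    simp only [mem_union, mem_filter]
    grind
  · rw [Finset.disjoint_left]
    simp only [mem_filter]
    grind

theorem card_ltPairs_union_swap {α : Type*} [LinearOrder α] {s t : Finset α}
    (h : Disjoint s t) :
    (ltPairs s t ∪ ltPairs t s).card = s.card * t.card := by
  rw [Finset.card_union_of_disjoint, ← card_ltPairs_add_card_ltPairs_add_card_inter,
    Finset.disjoint_iff_inter_eq_empty.mp h, Finset.card_empty, add_zero]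
  rw [Finset.disjoint_left] at h ⊢
  intro p hp hq
  rw [mem_ltPairs] at hp hq
  exact h hp.1.1 hq.1.1

theorem two_mul_card_ltPairs_self_add_card {α : Type*} [LinearOrder α] (s : Finset α) :
    2 * (ltPairs s s).card + s.card = s.card * s.card := by
  rw [← card_ltPairs_add_card_ltPairs_add_card_inter s s, Finset.inter_self]
  ring

/-- The positions at which `i` and `i'` take the values `x` and `y`. -/
def jointFiber {α : Type*} [Fintype α] (i i' : α → Bool) (x y : Bool) : Finset α :=
  Finset.univ.filter fun a => i a = x ∧ i' a = y

theorem mem_jointFiber {α : Type*} [Fintype α] {i i' : α → Bool} {x y : Bool} {a : α} :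
    a ∈ jointFiber i i' x y ↔ i a = x ∧ i' a = y := by
  simp [jointFiber]

theorem disjoint_jointFiber {α : Type*} [Fintype α] (i i' : α → Bool) {x y z w : Bool}
    (h : (x, y) ≠ (z, w)) : Disjoint (jointFiber i i' x y) (jointFiber i i' z w) := by
  rw [Finset.disjoint_left]
  intro a ha hb
  rw [mem_jointFiber] at ha hb
  exact h (Prod.ext (ha.1.symm.trans hb.1) (ha.2.symm.trans hb.2))

theorem wt_eq_card_jointFiber_left {α : Type*} [Fintype α] (i i' : α → Bool) :
    wt i = (jointFiber i i' true false).card + (jointFiber i i' true true).card := by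
  rw [← Finset.card_union_of_disjoint (disjoint_jointFiber i i' (by simp)), wt]
  congr 1
  ext a
  simp only [mem_filter, mem_union, mem_jointFiber, mem_univ]
  cases i' a <;> simp

theorem wt_eq_card_jointFiber_right {α : Type*} [Fintype α] (i i' : α → Bool) :
    wt i' = (jointFiber i i' false true).card + (jointFiber i i' true true).card := by
  rw [← Finset.card_union_of_disjoint (disjoint_jointFiber i i' (by simp)), wt]
  congr 1
  ext a
  simp only [mem_filter, mem_union, mem_jointFiber, mem_univ]
  cases i a <;> simp

/-- The positions at which `i` and `i'` differ. -/
noncomputable def diffSet {α : Type*} [Fintype α] (i i' : α → Bool) : Finset α :=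
  jointFiber i i' false true ∪ jointFiber i i' true false

theorem card_diffSet {α : Type*} [Fintype α] (i i' : α → Bool) :
    (diffSet i i').card =
      (jointFiber i i' false true).card + (jointFiber i i' true false).card :=
  Finset.card_union_of_disjoint (disjoint_jointFiber i i' (by simp))

theorem hammingDist_eq_card_diffSet {α : Type*} [Fintype α] (i i' : α → Bool) :
    hammingDist i i' = (diffSet i i').card := by
  rw [hammingDist]
  congr 1
  ext a
  simp only [diffSet, mem_filter, mem_union, mem_jointFiber, mem_univ]
  cases i a <;> cases i' a <;> simp

theorem disjoint_jointFiber_diffSet {α : Type*} [Fintype α] (i i' : α → Bool) (x : Bool) :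
    Disjoint (jointFiber i i' x x) (diffSet i i') :=
  Finset.disjoint_union_right.mpr
    ⟨disjoint_jointFiber i i' (by cases x <;> simp),
      disjoint_jointFiber i i' (by cases x <;> simp)⟩

theorem card_jointFiber_add_card_diffSet {α : Type*} [Fintype α] (i i' : α → Bool) :
    (jointFiber i i' false false).card + (jointFiber i i' true true).card
      + (diffSet i i').card = Fintype.card α := by
  rw [← Finset.card_union_of_disjoint (disjoint_jointFiber i i' (by simp)),
    ← Finset.card_union_of_disjoint (Finset.disjoint_union_left.mpr
      ⟨disjoint_jointFiber_diffSet i i' false, disjoint_jointFiber_diffSet i i' true⟩),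
    ← Finset.card_univ]
  congr 1
  ext a
  simp only [diffSet, mem_union, mem_jointFiber, mem_univ]
  cases i a <;> cases i' a <;> simp

theorem card_cls01 {α : Type*} [Fintype α] [LinearOrder α] (i i' : α → Bool) :
    (Finset.univ.filter (fun p : α × α => p.1 < p.2 ∧ cls01 i i' p.1 p.2)).card =
      (jointFiber i i' false false).card * (diffSet i i').card := by
  rw [← card_ltPairs_union_swap (disjoint_jointFiber_diffSet i i' false)]
  congr 1
  ext ⟨a, b⟩
  simp only [mem_filter, mem_univ, true_and, mem_union, mem_ltPairs]
  simp only [diffSet, mem_union, mem_jointFiber, cls01, rwt]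
  cases i a <;> cases i b <;> cases i' a <;> cases i' b <;> simp

theorem card_cls11 {α : Type*} [Fintype α] [LinearOrder α] (i i' : α → Bool) :
    (Finset.univ.filter (fun p : α × α => p.1 < p.2 ∧ cls11 i i' p.1 p.2)).card =
      (jointFiber i i' false true).card * (jointFiber i i' true false).card := by
  rw [← card_ltPairs_union_swap (disjoint_jointFiber i i' (by simp))]
  congr 1
  ext ⟨a, b⟩
  simp only [mem_filter, mem_univ, true_and, mem_union, mem_ltPairs]
  simp only [mem_jointFiber, cls11, rwt]
  cases i a <;> cases i b <;> cases i' a <;> cases i' b <;> simp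

theorem card_cls02 {α : Type*} [Fintype α] [LinearOrder α] (i i' : α → Bool) :
    (Finset.univ.filter (fun p : α × α => p.1 < p.2 ∧ cls02 i i' p.1 p.2)).card =
      (ltPairs (jointFiber i i' false true) (jointFiber i i' false true)).card
        + (ltPairs (jointFiber i i' true false) (jointFiber i i' true false)).card := by
  rw [← Finset.card_union_of_disjoint]
  · congr 1
    ext ⟨a, b⟩
    simp only [mem_filter, mem_univ, true_and, mem_union, mem_ltPairs]
    simp only [mem_jointFiber, cls02, rwt]
    cases i a <;> cases i b <;> cases i' a <;> cases i' b <;> simp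
  · rw [Finset.disjoint_left]
    simp only [mem_ltPairs, mem_jointFiber]
    grind

theorem card_cls12 {α : Type*} [Fintype α] [LinearOrder α] (i i' : α → Bool) :
    (Finset.univ.filter (fun p : α × α => p.1 < p.2 ∧ cls12 i i' p.1 p.2)).card =
      (jointFiber i i' true true).card * (diffSet i i').card := by
  rw [← card_ltPairs_union_swap (disjoint_jointFiber_diffSet i i' true)]
  congr 1
  ext ⟨a, b⟩
  simp only [mem_filter, mem_univ, true_and, mem_union, mem_ltPairs]
  simp only [diffSet, mem_union, mem_jointFiber, cls12, rwt]
  cases i a <;> cases i b <;> cases i' a <;> cases i' b <;> simp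

/-- Counting functions `f_{0:1}, f_{1:1}, f_{0:2}, f_{1:2}` of the `k_max`-LNN
probe-domain distribution: among all unordered pairs of distinct positions
(encoded as ordered pairs with `a < b`), the numbers of pairs of each class
for patterns of weights `u ≤ v` at Hamming distance `d`. -/
theorem stmt4 (m u v : ℕ) (huv : u ≤ v) (i i' : Fin m → Bool)
    (hi : wt i = u) (hi' : wt i' = v) (d : ℕ) (hd : hammingDist i i' = d) :
    (Finset.univ.filter
        (fun p : Fin m × Fin m => p.1 < p.2 ∧ cls01 i i' p.1 p.2)).card
      = d * (2 * m - (u + v) - d) / 2 ∧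
    (Finset.univ.filter
        (fun p : Fin m × Fin m => p.1 < p.2 ∧ cls11 i i' p.1 p.2)).card
      = (d ^ 2 - (v - u) ^ 2) / 4 ∧
    (Finset.univ.filter
        (fun p : Fin m × Fin m => p.1 < p.2 ∧ cls02 i i' p.1 p.2)).card
      = (d * (d - 2) + (v - u) ^ 2) / 4 ∧
    (Finset.univ.filter
        (fun p : Fin m × Fin m => p.1 < p.2 ∧ cls12 i i' p.1 p.2)).card
      = d * ((u + v) - d) / 2 := by
  have hu := wt_eq_card_jointFiber_left i i'
  have hv := wt_eq_card_jointFiber_right i i'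
  have hdist := hammingDist_eq_card_diffSet i i'
  have hm := card_jointFiber_add_card_diffSet i i'
  have hB := two_mul_card_ltPairs_self_add_card (jointFiber i i' false true)
  have hC := two_mul_card_ltPairs_self_add_card (jointFiber i i' true false)
  rw [Fintype.card_fin] at hm
  rw [card_cls01, card_cls11, card_cls02, card_cls12]
  rw [card_diffSet] at hdist hm ⊢
  generalize (jointFiber i i' false false).card = A at *
  generalize (jointFiber i i' true true).card = D at *
  generalize (ltPairs (jointFiber i i' false true) (jointFiber i i' false true)).card = X at *
  generalize (ltPairs (jointFiber i i' true false) (jointFiber i i' true false)).card = Y at *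
  generalize (jointFiber i i' false true).card = B at *
  generalize (jointFiber i i' true false).card = C at *
  obtain ⟨k, rfl⟩ : ∃ k, B = C + k := ⟨B - C, by omega⟩
  have hdiff : v - u = k := by omega
  have hd' : d = C + k + C := by omega
  rw [hdiff, hd']
  refine ⟨?_, ?_, ?_, ?_⟩
  · rw [show 2 * m - (u + v) - (C + k + C) = 2 * A by omega]
    symm
    apply Nat.div_eq_of_eq_mul_left two_pos
    ring
  · symm
    apply Nat.div_eq_of_eq_mul_left four_pos
    rw [Nat.sub_eq_iff_eq_add (Nat.pow_le_pow_left (by omega) 2)]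
    ring
  · obtain hlt | hge := lt_or_ge (C + k + C) 2
    · obtain rfl : C = 0 := by omega
      have hk : k < 2 := by omega
      interval_cases k <;> omega
    · obtain ⟨e, he⟩ : ∃ e, C + k + C = e + 2 := ⟨C + k + C - 2, by omega⟩
      symm
      apply Nat.div_eq_of_eq_mul_left four_pos
      rw [he, Nat.add_sub_cancel]
      zify at *
      have he' : (e : ℤ) = C + k + C - 2 := by omega
      rw [he']
      linear_combination -2 * hB - 2 * hC
  · rw [show u + v - (C + k + C) = 2 * D by omega]
    symm
    apply Nat.div_eq_of_eq_mul_left two_pos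
    ring
end

section
/- Let G be a k-regular simple graph on the vertex set {1,…,m} with 1 ≤ k < m, and let p ≠ p′ be two vertices. Let i = i^(p) be the binary pattern of length m with a single 1 at position p, and i′ = i^(p′) the pattern with a single 1 at position p′. Then the product of w(e) over all edges e of G equals F01^(2k−2) · F11 if {p,p′} is an edge of G, and equals F01^(2k) otherwise. -/
open Finset

/-- The single-target CPF pattern with its unique `1` at position `p`. -/
def single {m : ℕ} (p : Fin m) : Fin m → Bool := fun a => decide (a = p)

open scoped Classical in
/-- Product of `w` over all edges of a graph `G` (each unordered edge `{a,b}`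
encoded as the ordered pair with `a < b`). -/
noncomputable def Wgraph {m : ℕ} (G : SimpleGraph (Fin m)) (F01 F11 F02 F12 : ℝ)
    (i i' : Fin m → Bool) : ℝ :=
  ∏ p ∈ Finset.univ.filter (fun p : Fin m × Fin m => p.1 < p.2 ∧ G.Adj p.1 p.2),
    w F01 F11 F02 F12 i i' p.1 p.2

theorem card_filter_lt_adj_incident {α : Type*} [Fintype α] [LinearOrder α] (G : SimpleGraph α)
    [DecidableRel G.Adj] (v : α) :
    #{e : α × α | (e.1 < e.2 ∧ G.Adj e.1 e.2) ∧ (e.1 = v ∨ e.2 = v)} = G.degree v := by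
  rw [← G.card_neighborFinset_eq_degree]
  symm
  refine Finset.card_bij (fun c _ => (min v c, max v c)) ?_ ?_ ?_
  · intro c hc
    rw [SimpleGraph.mem_neighborFinset] at hc
    rcases lt_or_gt_of_ne hc.ne with h | h
    · simp [min_eq_left h.le, max_eq_right h.le, h, hc]
    · simp [min_eq_right h.le, max_eq_left h.le, h, hc.symm]
  · intro c _ d _ h
    rw [Prod.mk.injEq] at h
    grind
  · rintro ⟨a, b⟩ h
    simp only [mem_filter, mem_univ, true_and] at h
    obtain ⟨⟨hlt, hadj⟩, rfl | rfl⟩ := h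
    · exact ⟨b, by simpa using hadj, by simp [hlt.le]⟩
    · exact ⟨a, by simpa using hadj.symm, by simp [hlt.le]⟩

theorem w_single_of_lt {m : ℕ} {F01 : ℝ} (hF01 : F01 ≠ 0) (F11 F02 F12 : ℝ) {p p' a b : Fin m}
    (hpp : p ≠ p') (hab : a < b) :
    w F01 F11 F02 F12 (single p) (single p') a b =
      (if a = p ∨ b = p then F01 else 1) * (if a = p' ∨ b = p' then F01 else 1) *
        (if (a, b) = (min p p', max p p') then F11 / F01 ^ 2 else 1) := by
  have hp' := hpp.symm
  have hend : (a, b) = (min p p', max p p') ↔ a = p ∧ b = p' ∨ a = p' ∧ b = p := by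
    rw [Prod.mk.injEq]
    grind
  have hba := hab.ne'
  simp only [hend, w, rwt, single]
  by_cases h1 : a = p <;> by_cases h2 : b = p <;> by_cases h3 : a = p' <;>
    by_cases h4 : b = p' <;> simp_all <;> field_simp

/-- For a `k`-regular graph `G` on `m` vertices (`1 ≤ k < m`) and distinct vertices
`p ≠ p'`, the product of `w` over the edges of `G`, computed from the single-target
patterns at `p` and `p'`, equals `F01^(2k-2) F11` if `{p,p'}` is an edge of `G`,
and `F01^(2k)` otherwise. -/
theorem stmt6 {m k : ℕ} (hk1 : 1 ≤ k) (hkm : k < m)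
    (G : SimpleGraph (Fin m)) [DecidableRel G.Adj] (hreg : G.IsRegularOfDegree k)
    (F01 F11 F02 F12 : ℝ)
    (hF01 : 0 < F01) (hF11 : 0 < F11) (hF02 : 0 < F02) (hF12 : 0 < F12)
    (p p' : Fin m) (hpp : p ≠ p') :
    Wgraph G F01 F11 F02 F12 (single p) (single p') =
      if G.Adj p p' then F01 ^ (2 * k - 2) * F11 else F01 ^ (2 * k) := by
  classical
  have hw : ∀ e ∈ ({e | e.1 < e.2 ∧ G.Adj e.1 e.2} : Finset (Fin m × Fin m)),
      w F01 F11 F02 F12 (single p) (single p') e.1 e.2 =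
        (if e.1 = p ∨ e.2 = p then F01 else 1) * (if e.1 = p' ∨ e.2 = p' then F01 else 1) *
          (if e = (min p p', max p p') then F11 / F01 ^ 2 else 1) := fun e he =>
    w_single_of_lt hF01.ne' F11 F02 F12 hpp (Finset.mem_filter.mp he).2.1
  have hincident (v : Fin m) :
      ∏ e : Fin m × Fin m with e.1 < e.2 ∧ G.Adj e.1 e.2,
        (if e.1 = v ∨ e.2 = v then F01 else 1) = F01 ^ k := by
    rw [← Finset.prod_filter, Finset.prod_const, Finset.filter_filter,
      card_filter_lt_adj_incident, hreg.degree_eq]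
  have hmem : (min p p', max p p') ∈
      ({e | e.1 < e.2 ∧ G.Adj e.1 e.2} : Finset (Fin m × Fin m)) ↔ G.Adj p p' := by
    rcases lt_or_gt_of_ne hpp with h | h
    · simp [min_eq_left h.le, max_eq_right h.le, h]
    · simp [min_eq_right h.le, max_eq_left h.le, h, G.adj_comm]
  have hprod : Wgraph G F01 F11 F02 F12 (single p) (single p') =
      F01 ^ k * F01 ^ k * (if G.Adj p p' then F11 / F01 ^ 2 else 1) := by
    unfold Wgraph
    trans ∏ e : Fin m × Fin m with e.1 < e.2 ∧ G.Adj e.1 e.2,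
      w F01 F11 F02 F12 (single p) (single p') e.1 e.2
    · congr!
    rw [Finset.prod_congr rfl hw, Finset.prod_mul_distrib, Finset.prod_mul_distrib, hincident, hincident,
      Finset.prod_ite_eq']
    simp only [hmem]
  rw [hprod]
  obtain ⟨n, rfl⟩ := Nat.exists_eq_add_of_le hk1
  split_ifs
  · rw [show 2 * (1 + n) - 2 = 2 * n by omega]
    field_simp
    ring
  · ring
end

section
/- Let G be a k-regular simple graph on the vertex set {1,…,m} with 1 ≤ k < m, let M be a natural number, and let F01, F11 be positive reals. For distinct vertices p ≠ p′, let W(p,p′) be the product of w(e) over all edges e of G, where w is computed from the single-target patterns i^(p) and i^(p′). Then the sum over all ordered pairs of distinct vertices (p, p′) of W(p,p′)^M equals k·m·F01^((2k−2)M)·F11^M + (m(m−1) − km)·F01^(2kM). -/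
open Finset

theorem prod_lt_adj_mul_eq_prod_pow_degree {m : ℕ} (G : SimpleGraph (Fin m))
    [DecidableRel G.Adj] (g : Fin m → ℝ) :
    ∏ p ∈ Finset.univ.filter (fun p : Fin m × Fin m => p.1 < p.2 ∧ G.Adj p.1 p.2),
      (g p.1 * g p.2) = ∏ a, g a ^ G.degree a := by
  have hswap : ∏ p ∈ Finset.univ.filter (fun p : Fin m × Fin m => p.1 < p.2 ∧ G.Adj p.1 p.2),
      g p.2 = ∏ p ∈ Finset.univ.filter (fun p : Fin m × Fin m => p.2 < p.1 ∧ G.Adj p.1 p.2),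
      g p.1 :=
    Finset.prod_equiv (Equiv.prodComm _ _) (by simp [G.adj_comm]) (by simp)
  have hdeg (a : Fin m) : g a ^ G.degree a = ∏ b, if G.Adj a b then g a else 1 := by
    rw [← Finset.prod_filter, Finset.prod_const, ← G.neighborFinset_eq_filter,
      G.card_neighborFinset_eq_degree]
  simp_rw [hdeg]
  rw [Finset.prod_mul_distrib, hswap, Finset.prod_filter, Finset.prod_filter,
    ← Finset.prod_mul_distrib, Fintype.prod_prod_type]
  refine Finset.prod_congr rfl fun a _ => Finset.prod_congr rfl fun b _ => ?_
  rcases lt_trichotomy a b with h | h | h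
  · simp [h, h.not_gt]
  · simp [h]
  · simp [h, h.not_gt]

theorem w_single_eq {m : ℕ} {F01 : ℝ} (hF01 : F01 ≠ 0) (F11 F02 F12 : ℝ)
    {p q a b : Fin m} (hpq : p ≠ q) (hab : a ≠ b) :
    w F01 F11 F02 F12 (single p) (single q) a b =
      (if a = p ∨ a = q then F01 else 1) * (if b = p ∨ b = q then F01 else 1) *
        (if (a = p ∧ b = q) ∨ (a = q ∧ b = p) then F11 / F01 ^ 2 else 1) := by
  have hqp := hpq.symm
  have hba := hab.symm
  have hF : F01 * F01 * (F11 / F01 ^ 2) = F11 := by field_simp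
  by_cases h1 : a = p
  · subst h1
    by_cases h2 : b = q
    · subst h2
      simp [w, rwt, single, hpq, hqp, hF]
    · simp [w, rwt, single, hpq, hba, h2]
  by_cases h3 : a = q
  · subst h3
    by_cases h2 : b = p
    · subst h2
      simp [w, rwt, single, hpq, hqp, hF]
    · simp [w, rwt, single, hqp, hba, h2]
  by_cases h4 : b = p
  · subst h4
    simp [w, rwt, single, hpq, h1, h3]
  by_cases h5 : b = q
  · subst h5
    simp [w, rwt, single, hqp, h1, h3]
  simp [w, single, h1, h3, h4, h5]

theorem Wgraph_single {m k : ℕ} (hk1 : 1 ≤ k) (G : SimpleGraph (Fin m)) [DecidableRel G.Adj]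
    (hreg : G.IsRegularOfDegree k) {F01 : ℝ} (hF01 : F01 ≠ 0) (F11 F02 F12 : ℝ)
    {p q : Fin m} (hpq : p ≠ q) :
    Wgraph G F01 F11 F02 F12 (single p) (single q) =
      if G.Adj p q then F01 ^ (2 * k - 2) * F11 else F01 ^ (2 * k) := by
  classical
  have hvert : ∏ a, (if a = p ∨ a = q then F01 else 1) ^ G.degree a = F01 ^ (2 * k) := by
    simp_rw [hreg.degree_eq]
    rw [Finset.prod_pow, ← Finset.prod_filter, Finset.prod_const]
    have : Finset.univ.filter (fun a => a = p ∨ a = q) = {p, q} := by ext; simp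
    rw [this, Finset.card_pair hpq, ← pow_mul]
  have hedge (c : ℝ) :
      ∏ e ∈ Finset.univ.filter (fun e : Fin m × Fin m => e.1 < e.2 ∧ G.Adj e.1 e.2),
        (if (e.1 = p ∧ e.2 = q) ∨ (e.1 = q ∧ e.2 = p) then c else 1) =
      if G.Adj p q then c else 1 := by
    rw [← Finset.prod_filter, Finset.filter_filter, Finset.prod_const]
    split_ifs with hadj
    · have : Finset.univ.filter (fun e : Fin m × Fin m => (e.1 < e.2 ∧ G.Adj e.1 e.2) ∧
          ((e.1 = p ∧ e.2 = q) ∨ (e.1 = q ∧ e.2 = p))) =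
          {(if p < q then (p, q) else (q, p))} := by
        ext ⟨a, b⟩
        have := hadj.symm
        simp only [Finset.mem_filter, Finset.mem_univ, true_and, Finset.mem_singleton]
        rcases hpq.lt_or_gt with h | h
        · grind
        · grind
      rw [this, Finset.card_singleton, pow_one]
    · have : Finset.univ.filter (fun e : Fin m × Fin m => (e.1 < e.2 ∧ G.Adj e.1 e.2) ∧
          ((e.1 = p ∧ e.2 = q) ∨ (e.1 = q ∧ e.2 = p))) = ∅ := by
        ext ⟨a, b⟩
        have : ¬ G.Adj q p := fun h => hadj h.symm
        simp only [Finset.mem_filter, Finset.mem_univ, true_and, Finset.notMem_empty, iff_false]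
        grind
      rw [this, Finset.card_empty, pow_zero]
  have hprod : Wgraph G F01 F11 F02 F12 (single p) (single q) =
      F01 ^ (2 * k) * if G.Adj p q then F11 / F01 ^ 2 else 1 := by
    rw [← hedge, ← hvert, ← prod_lt_adj_mul_eq_prod_pow_degree, ← Finset.prod_mul_distrib, Wgraph]
    refine Finset.prod_congr (by ext; simp) fun e he => ?_
    exact w_single_eq hF01 F11 F02 F12 hpq (Finset.mem_filter.1 he).2.1.ne
  rw [hprod]
  split_ifs
  · obtain ⟨j, rfl⟩ := Nat.exists_eq_add_of_le hk1
    rw [show 2 * (1 + j) - 2 = 2 * j by omega, show 2 * (1 + j) = 2 * j + 2 by ring, pow_add]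
    field_simp
  · rw [mul_one]

theorem card_offDiag_filter_adj {m k : ℕ} (G : SimpleGraph (Fin m)) [DecidableRel G.Adj]
    (hreg : G.IsRegularOfDegree k) :
    ((Finset.univ : Finset (Fin m)).offDiag.filter (fun q => G.Adj q.1 q.2)).card = k * m := by
  have : (Finset.univ : Finset (Fin m)).offDiag.filter (fun q => G.Adj q.1 q.2) =
      Finset.univ.filter (fun q : Fin m × Fin m => G.Adj q.1 q.2) := by
    ext ⟨a, b⟩
    simpa using fun h : G.Adj a b => h.ne
  rw [this, Finset.card_filter, Fintype.sum_prod_type]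
  simp_rw [← Finset.card_filter, ← G.neighborFinset_eq_filter, G.card_neighborFinset_eq_degree,
    hreg.degree_eq]
  simp [mul_comm]

/-- Total error quantity of the `M`-copy `k`-LNN protocol over the CPF image space:
the sum over ordered pairs of distinct vertices `(p,p')` of the `M`-th power of the
product of `w` over the edges of the `k`-regular graph `G` equals
`km F01^((2k-2)M) F11^M + (m(m-1) - km) F01^(2kM)`. -/
theorem stmt7 {m k : ℕ} (hk1 : 1 ≤ k) (hkm : k < m)
    (G : SimpleGraph (Fin m)) [DecidableRel G.Adj] (hreg : G.IsRegularOfDegree k)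
    (M : ℕ) (F01 F11 F02 F12 : ℝ)
    (hF01 : 0 < F01) (hF11 : 0 < F11) (hF02 : 0 < F02) (hF12 : 0 < F12) :
    ∑ q ∈ (Finset.univ : Finset (Fin m)).offDiag,
        (Wgraph G F01 F11 F02 F12 (single q.1) (single q.2)) ^ M
      = (k : ℝ) * (m : ℝ) * F01 ^ ((2 * k - 2) * M) * F11 ^ M
        + ((m : ℝ) * ((m : ℝ) - 1) - (k : ℝ) * (m : ℝ)) * F01 ^ (2 * k * M) := by
  have hval : ∀ q ∈ (Finset.univ : Finset (Fin m)).offDiag,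
      (Wgraph G F01 F11 F02 F12 (single q.1) (single q.2)) ^ M =
        if G.Adj q.1 q.2 then F01 ^ ((2 * k - 2) * M) * F11 ^ M else F01 ^ (2 * k * M) := by
    intro q hq
    rw [Wgraph_single hk1 G hreg hF01.ne' F11 F02 F12 (Finset.mem_offDiag.1 hq).2.2]
    split_ifs
    · rw [mul_pow, ← pow_mul]
    · rw [← pow_mul]
  have hadj := card_offDiag_filter_adj G hreg
  have hcard := Finset.card_filter_add_card_filter_not
    (s := (Finset.univ : Finset (Fin m)).offDiag) (fun q => G.Adj q.1 q.2)
  have hm : ((Finset.univ : Finset (Fin m)).offDiag.card : ℝ) = m * (m - 1) := by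
    rw [Finset.offDiag_card, Nat.cast_sub (Nat.le_mul_self _)]
    simp
    ring
  have hnadj : (((Finset.univ : Finset (Fin m)).offDiag.filter
      (fun q => ¬ G.Adj q.1 q.2)).card : ℝ) = m * (m - 1) - k * m := by
    rw [← hm, ← hcard, hadj]
    push_cast
    ring
  rw [Finset.sum_congr rfl hval, Finset.sum_ite, Finset.sum_const, Finset.sum_const,
    nsmul_eq_mul, nsmul_eq_mul, hnadj, hadj]
  push_cast
  ring
end

section
/- Let G be the complete graph on {1,…,m} with m ≥ 2, let M be a natural number, and let F01, F11 be positive reals. For distinct vertices p ≠ p′, let W(p,p′) be the product of w(e) over all edges e of G, computed from the single-target patterns i^(p) and i^(p′). Then the sum over all ordered pairs of distinct vertices (p,p′) of W(p,p′)^M equals m(m−1)·F01^(2(m−2)M)·F11^M. In particular every ordered pair contributes the same value (F01^(2(m−2))·F11)^M. -/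
open Finset

/-- The contribution of the ordered pair `(a, b)` to the weight of the edge `{a, b}` computed from
the single-target patterns at `p` and `p'`, attributed to the endpoint `a`. -/
def halfWeight {α : Type*} [DecidableEq α] (F01 F11 : ℝ) (p p' a b : α) : ℝ :=
  if a = p then (if b = p' then F11 else F01)
  else if a = p' then (if b = p then 1 else F01)
  else 1

lemma w_single_eq_halfWeight_mul {m : ℕ} (F01 F11 F02 F12 : ℝ) {p p' a b : Fin m}
    (hp : p ≠ p') (hab : a ≠ b) :
    w F01 F11 F02 F12 (single p) (single p') a b =
      halfWeight F01 F11 p p' b a * halfWeight F01 F11 p p' a b := by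
  by_cases h1 : a = p <;> by_cases h2 : a = p' <;> by_cases h3 : b = p <;>
    by_cases h4 : b = p' <;> simp_all [w, rwt, single, halfWeight]

lemma prod_compl_singleton_ite {α : Type*} [Fintype α] [DecidableEq α] {a b : α} (hab : a ≠ b)
    (x y : ℝ) :
    ∏ j ∈ ({a}ᶜ : Finset α), (if j = b then x else y) = x * y ^ (Fintype.card α - 2) := by
  have hb : b ∈ ({a}ᶜ : Finset α) := by simpa using hab.symm
  rw [← Finset.mul_prod_erase _ _ hb, if_pos rfl,
    Finset.prod_congr rfl fun j hj => if_neg (Finset.ne_of_mem_erase hj), Finset.prod_const,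
    Finset.card_erase_of_mem hb, Finset.card_compl, Finset.card_singleton, Nat.sub_sub]

lemma prod_halfWeight {α : Type*} [Fintype α] [DecidableEq α] (F01 F11 : ℝ) {p p' : α}
    (hp : p ≠ p') :
    ∏ a, ∏ b ∈ ({a}ᶜ : Finset α), halfWeight F01 F11 p p' a b =
      F01 ^ (2 * (Fintype.card α - 2)) * F11 := by
  rw [Fintype.prod_eq_mul p p' hp]
  · simp only [halfWeight, if_true, if_neg hp.symm]
    rw [prod_compl_singleton_ite hp, prod_compl_singleton_ite hp.symm]
    ring
  · rintro a ⟨h1, h2⟩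
    simp [halfWeight, h1, h2]

lemma Wgraph_top_eq_prod_Ioi {m : ℕ} (F01 F11 F02 F12 : ℝ) (i i' : Fin m → Bool) :
    Wgraph ⊤ F01 F11 F02 F12 i i' = ∏ a, ∏ b ∈ Finset.Ioi a, w F01 F11 F02 F12 i i' a b := by
  unfold Wgraph
  refine Finset.prod_finset_product' _ _ _ fun q => ?_
  simpa using fun h : q.1 < q.2 => h.ne

lemma Wgraph_top_single {m : ℕ} (F01 F11 F02 F12 : ℝ) {p p' : Fin m} (hp : p ≠ p') :
    Wgraph ⊤ F01 F11 F02 F12 (single p) (single p') = F01 ^ (2 * (m - 2)) * F11 := by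
  have key := prod_halfWeight F01 F11 hp
  rw [Fintype.card_fin] at key
  rw [Wgraph_top_eq_prod_Ioi, ← key,
    ← Finset.prod_prod_Ioi_mul_eq_prod_prod_off_diag
      (fun a b => halfWeight F01 F11 p p' b a)]
  refine Finset.prod_congr rfl fun a _ => Finset.prod_congr rfl fun b hb => ?_
  rw [w_single_eq_halfWeight_mul F01 F11 F02 F12 hp (Finset.mem_Ioi.mp hb).ne, mul_comm]

/-- For the complete graph (the `k_max = m-1`-LNN probe-domain distribution) on
`m ≥ 2` vertices, the total error quantity over the CPF image space equals
`m(m-1) F01^(2(m-2)M) F11^M`; in particular every ordered pair of distinct vertices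
contributes the same value `(F01^(2(m-2)) F11)^M`. -/
theorem stmt9 {m : ℕ} (hm : 2 ≤ m) (M : ℕ) (F01 F11 F02 F12 : ℝ)
    (hF01 : 0 < F01) (hF11 : 0 < F11) (hF02 : 0 < F02) (hF12 : 0 < F12) :
    (∑ q ∈ (Finset.univ : Finset (Fin m)).offDiag,
        (Wgraph ⊤ F01 F11 F02 F12 (single q.1) (single q.2)) ^ M
      = (m : ℝ) * ((m : ℝ) - 1) * F01 ^ (2 * (m - 2) * M) * F11 ^ M) ∧
    ∀ p p' : Fin m, p ≠ p' →
      (Wgraph ⊤ F01 F11 F02 F12 (single p) (single p')) ^ M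
        = (F01 ^ (2 * (m - 2)) * F11) ^ M := by
  have single_pair : ∀ p p' : Fin m, p ≠ p' →
      (Wgraph ⊤ F01 F11 F02 F12 (single p) (single p')) ^ M
        = (F01 ^ (2 * (m - 2)) * F11) ^ M := fun p p' hp => by
    rw [Wgraph_top_single F01 F11 F02 F12 hp]
  refine ⟨?_, single_pair⟩
  rw [Finset.sum_congr rfl fun q hq => single_pair q.1 q.2 (Finset.mem_offDiag.mp hq).2.2,
    Finset.sum_const, Finset.offDiag_card, Finset.card_univ, Fintype.card_fin, nsmul_eq_mul,
    Nat.cast_sub (Nat.le_mul_self m), Nat.cast_mul, mul_pow, ← pow_mul]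
  ring
end

section
/- Let m = 2l be even, M a natural number, and F01, F11, F02, F12 positive reals. For binary patterns i, i′ of length m, let W(i,i′) be the product over j = 1,…,l of w({2j−1, 2j}). Then the sum over all ordered pairs (i, i′) of distinct binary patterns of length m of W(i,i′)^M equals 2^m · ( (1 + F01^M + F12^M + (F11^M + F02^M)/2)^l − 1 ); equivalently, 2^(−m) times this sum equals (1 + F01^M + F12^M + (F11^M + F02^M)/2)^(m/2) − 1. -/
open Finset

/-- Splitting a binary pattern of length `2 * l` into its `l` consecutive pairs of bits. -/
def pairsEquiv {m l : ℕ} (hm : m = 2 * l) : (Fin m → Bool) ≃ (Fin l → Bool × Bool) where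
  toFun i j := (i ⟨2 * (j : ℕ), by omega⟩, i ⟨2 * (j : ℕ) + 1, by omega⟩)
  invFun p k := if (k : ℕ) % 2 = 0 then (p ⟨k / 2, by omega⟩).1 else (p ⟨k / 2, by omega⟩).2
  left_inv i := by
    funext k
    dsimp only
    split_ifs with h <;> congr 1 <;> ext <;> dsimp only <;> omega
  right_inv p := by
    funext j
    have h : (2 * (j : ℕ) + 1) / 2 = j := by omega
    ext <;> simp [h, Nat.add_mod]

/-- Summing a product of blockwise factors over all pairs of sequences of length `l`
factorizes into an `l`-th power. -/
theorem sum_sum_prod_eq_pow {β R : Type*} [Fintype β] [CommSemiring R]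
    (l : ℕ) (g : β → β → R) :
    ∑ p : Fin l → β, ∑ p' : Fin l → β, ∏ j, g (p j) (p' j) = (∑ b, ∑ b', g b b') ^ l := by
  calc ∑ p : Fin l → β, ∑ p' : Fin l → β, ∏ j, g (p j) (p' j)
      = ∑ p : Fin l → β, ∏ j, ∑ b', g (p j) b' :=
        sum_congr rfl fun p _ => (Fintype.prod_sum fun j b' => g (p j) b').symm
    _ = ∏ _j : Fin l, ∑ b, ∑ b', g b b' :=
        (Fintype.prod_sum fun (_ : Fin l) b => ∑ b', g b b').symm
    _ = (∑ b, ∑ b', g b b') ^ l := by simp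

/-- The sub-fidelity weight as a function of the two restrictions to a pair of positions. -/
noncomputable def blockWeight (F01 F11 F02 F12 : ℝ) (p p' : Bool × Bool) : ℝ :=
  w F01 F11 F02 F12 (fun c : Bool => bif c then p.2 else p.1)
    (fun c : Bool => bif c then p'.2 else p'.1) false true

theorem sum_blockWeight_pow (F01 F11 F02 F12 : ℝ) (M : ℕ) :
    ∑ p, ∑ p', blockWeight F01 F11 F02 F12 p p' ^ M =
      4 * (1 + F01 ^ M + F12 ^ M + (F11 ^ M + F02 ^ M) / 2) := by
  simp [Fintype.sum_prod_type, blockWeight, w, rwt]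
  ring

/-- The error quantity including the diagonal pairs. -/
theorem sum_sum_prod_w_pow {m l : ℕ} (hm : m = 2 * l) (M : ℕ) (F01 F11 F02 F12 : ℝ) :
    ∑ i : Fin m → Bool, ∑ i' : Fin m → Bool,
        (∏ j : Fin l, w F01 F11 F02 F12 i i'
          ⟨2 * (j : ℕ), by omega⟩ ⟨2 * (j : ℕ) + 1, by omega⟩) ^ M
      = 2 ^ m * (1 + F01 ^ M + F12 ^ M + (F11 ^ M + F02 ^ M) / 2) ^ l := by
  have h4 : (2 : ℝ) ^ m = 4 ^ l := by rw [hm, pow_mul]; norm_num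
  rw [h4, ← mul_pow, ← sum_blockWeight_pow, ← sum_sum_prod_eq_pow,
    ← (pairsEquiv hm).sum_comp]
  refine sum_congr rfl fun i _ => ?_
  rw [← (pairsEquiv hm).sum_comp]
  refine sum_congr rfl fun i' _ => ?_
  rw [← prod_pow]
  rfl

/-- Total error quantity of the fixed block protocol with disjoint two-mode probe
domains `{2j-1, 2j}` (zero-indexed: `{2j, 2j+1}`, `j = 0,…,l-1`) over the uniform
image space of all `2^m` binary patterns of even length `m = 2l`. -/
theorem stmt10 (m l : ℕ) (hm : m = 2 * l) (M : ℕ) (F01 F11 F02 F12 : ℝ)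
    (hF01 : 0 < F01) (hF11 : 0 < F11) (hF02 : 0 < F02) (hF12 : 0 < F12) :
    (∑ q ∈ (Finset.univ : Finset (Fin m → Bool)).offDiag,
        (∏ j : Fin l, w F01 F11 F02 F12 q.1 q.2
            ⟨2 * (j : ℕ), by have := j.isLt; omega⟩
            ⟨2 * (j : ℕ) + 1, by have := j.isLt; omega⟩) ^ M
      = 2 ^ m * ((1 + F01 ^ M + F12 ^ M + (F11 ^ M + F02 ^ M) / 2) ^ l - 1)) ∧
    (∑ q ∈ (Finset.univ : Finset (Fin m → Bool)).offDiag,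
        (∏ j : Fin l, w F01 F11 F02 F12 q.1 q.2
            ⟨2 * (j : ℕ), by have := j.isLt; omega⟩
            ⟨2 * (j : ℕ) + 1, by have := j.isLt; omega⟩) ^ M) / 2 ^ m
      = (1 + F01 ^ M + F12 ^ M + (F11 ^ M + F02 ^ M) / 2) ^ (m / 2) - 1 := by
  have key : ∑ q ∈ (Finset.univ : Finset (Fin m → Bool)).offDiag,
        (∏ j : Fin l, w F01 F11 F02 F12 q.1 q.2
            ⟨2 * (j : ℕ), by have := j.isLt; omega⟩
            ⟨2 * (j : ℕ) + 1, by have := j.isLt; omega⟩) ^ M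
      = 2 ^ m * ((1 + F01 ^ M + F12 ^ M + (F11 ^ M + F02 ^ M) / 2) ^ l - 1) := by
    have hall := sum_sum_prod_w_pow hm M F01 F11 F02 F12
    rw [← sum_product', ← diag_union_offDiag, sum_union (disjoint_diag_offDiag _),
      sum_diag] at hall
    have hdiag : ∑ i : Fin m → Bool, (∏ j : Fin l, w F01 F11 F02 F12 i i
        ⟨2 * (j : ℕ), by omega⟩ ⟨2 * (j : ℕ) + 1, by omega⟩) ^ M = 2 ^ m := by
      simp [w]
    rw [hdiag] at hall
    linear_combination hall
  refine ⟨key, ?_⟩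
  have hl : m / 2 = l := by omega
  rw [key, hl, mul_div_cancel_left₀ _ (by positivity)]
end

section
/- Let m ≥ 2 be an integer, let F_cl, F01, F11 be reals in the open interval (0,1), set Q = F01^(2(m−2))·F11, and suppose the denominator Δ := 4·log₁₀(F_cl) − (1/(m−1))·log₁₀(Q) is positive. Then for every real M > 0 with M ≥ log₁₀(2m)/Δ, one has (m−1)·Q^(M/(m−1)) ≤ ((m−1)/(2m))·F_cl^(4M); that is, the quantum idler-free upper bound on the error probability of the k_max-LNN channel-position-finding protocol (using M/(m−1) probe copies, matching the classical average channel use) is at most the classical lower bound (m−1)/(2m)·F_cl^(4M). -/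
/-- Guaranteed quantum advantage for `k_max`-LNN channel-position finding:
if `Q = F01^(2(m-2)) F11` and the denominator
`Δ = 4 log₁₀ F_cl - (1/(m-1)) log₁₀ Q` is positive, then for every `M > 0` with
`M ≥ log₁₀(2m)/Δ`, the idler-free quantum upper bound `(m-1) Q^(M/(m-1))`
(using `M/(m-1)` probe copies, matching the classical average channel use) is at
most the classical lower bound `((m-1)/(2m)) F_cl^(4M)`. -/
theorem stmt15 (m : ℕ) (hm : 2 ≤ m) (Fcl F01 F11 : ℝ)
    (hFcl : Fcl ∈ Set.Ioo (0 : ℝ) 1) (hF01 : F01 ∈ Set.Ioo (0 : ℝ) 1)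
    (hF11 : F11 ∈ Set.Ioo (0 : ℝ) 1)
    (Q : ℝ) (hQ : Q = F01 ^ (2 * (m - 2)) * F11)
    (hΔ : 0 < 4 * Real.logb 10 Fcl - (1 / ((m : ℝ) - 1)) * Real.logb 10 Q) :
    ∀ M : ℝ, 0 < M →
      Real.logb 10 (2 * m) /
          (4 * Real.logb 10 Fcl - (1 / ((m : ℝ) - 1)) * Real.logb 10 Q) ≤ M →
      ((m : ℝ) - 1) * Q ^ (M / ((m : ℝ) - 1)) ≤
        (((m : ℝ) - 1) / (2 * m)) * Fcl ^ (4 * M) := by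
  intro M _ hM
  rw [div_le_iff₀ hΔ] at hM
  have hm' : (2 : ℝ) ≤ m := by exact_mod_cast hm
  have hm1 : (0 : ℝ) < m - 1 := by linarith
  have h2m : (0 : ℝ) < 2 * m := by linarith
  have hQ0 : 0 < Q := hQ ▸ mul_pos (pow_pos hF01.1 _) hF11.1
  have hQM : 0 < Q ^ (M / ((m : ℝ) - 1)) := Real.rpow_pos_of_pos hQ0 _
  have key : 2 * m * Q ^ (M / ((m : ℝ) - 1)) ≤ Fcl ^ (4 * M) := by
    rw [← Real.logb_le_logb (b := 10) (by norm_num) (mul_pos h2m hQM)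
        (Real.rpow_pos_of_pos hFcl.1 _),
      Real.logb_mul h2m.ne' hQM.ne', Real.logb_rpow_eq_mul_logb_of_pos hQ0,
      Real.logb_rpow_eq_mul_logb_of_pos hFcl.1]
    linear_combination hM
  calc ((m : ℝ) - 1) * Q ^ (M / ((m : ℝ) - 1))
      = (((m : ℝ) - 1) / (2 * m)) * (2 * m * Q ^ (M / ((m : ℝ) - 1))) := by
        field_simp
    _ ≤ (((m : ℝ) - 1) / (2 * m)) * Fcl ^ (4 * M) := by gcongr
end
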